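/- arXiv:1501.07369 — 4 statements merged into one kernel-verified Lean document; each statement's English description precedes it below -/
import Mathlib

section
/- Let k be an integral domain with field of fractions K, let A and B be associative unital k-algebras, and let φ : A → B be a k-algebra homomorphism such that the induced map K ⊗_k A → K ⊗_k B is an isomorphism. Then the restriction-of-scalars functor along φ is fully faithful on B-modules that are free as k-modules; that is, for any two left B-modules M and N whose underlying k-modules are free, every A-module homomorphism M → N is automatically B-linear, so the natural map Hom_B(M, N) → Hom_A(M, N) is bijective. -/
open scoped TensorProduct

/-- If `φ` is surjective after base change to the fraction field, then every element of the
codomain has a nonzero multiple in the range of `φ`. -/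
theorem exists_smul_eq_of_surjective_baseChange {k A B : Type*} [CommRing k] [IsDomain k]
    [AddCommGroup A] [AddCommGroup B] [Module k A] [Module k B] (φ : A →ₗ[k] B)
    (hφ : Function.Surjective (φ.baseChange (FractionRing k))) (b : B) :
    ∃ s : k, s ≠ 0 ∧ ∃ a : A, s • b = φ a := by
  obtain ⟨x, hx⟩ := hφ (1 ⊗ₜ[k] b)
  obtain ⟨⟨a, s⟩, hs⟩ := IsLocalizedModule.surj (nonZeroDivisors k)
    (TensorProduct.mk k (FractionRing k) A 1) x
  have h : TensorProduct.mk k (FractionRing k) B 1 ((s : k) • b) =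
      TensorProduct.mk k (FractionRing k) B 1 (φ a) := by
    have h' := congrArg ((φ.baseChange (FractionRing k)).restrictScalars k) hs
    simpa [Submonoid.smul_def, hx] using h'
  obtain ⟨t, ht⟩ := IsLocalizedModule.exists_of_eq (S := nonZeroDivisors k) h
  refine ⟨t * s, nonZeroDivisors.coe_ne_zero (t * s), (t : k) • a, ?_⟩
  simpa [Submonoid.smul_def, mul_smul] using ht

/-- **Key lemma (Lemma 1.6).** Let `k` be an integral domain with field of fractions `K`,
let `A` and `B` be `k`-algebras, and let `φ : A → B` be a `k`-algebra homomorphism such that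
the induced map `K ⊗[k] A → K ⊗[k] B` is an isomorphism (i.e. bijective).  Then restriction
of scalars along `φ` is fully faithful on `B`-modules which are free over `k`: every
`A`-linear (i.e. additive and `φ`-equivariant) map between two such `B`-modules is
automatically `B`-linear, so that `Hom_B(M, N) → Hom_A(M, N)` is bijective. -/
theorem stmt0 (k : Type*) [CommRing k] [IsDomain k]
    (A B : Type*) [Ring A] [Ring B] [Algebra k A] [Algebra k B]
    (φ : A →ₐ[k] B)
    (hφ : Function.Bijective
      (LinearMap.baseChange (FractionRing k) (φ.toLinearMap : A →ₗ[k] B)))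
    (M N : Type*) [AddCommGroup M] [AddCommGroup N]
    [Module k M] [Module B M] [IsScalarTower k B M]
    [Module k N] [Module B N] [IsScalarTower k B N]
    [Module.Free k M] [Module.Free k N]
    (f : M →+ N) (hf : ∀ (a : A) (m : M), f (φ a • m) = φ a • f m) :
    ∀ (b : B) (m : M), f (b • m) = b • f m := by
  have f_smul (s : k) (m : M) : f (s • m) = s • f m := by
    simpa using hf (algebraMap k A s) m
  intro b m
  obtain ⟨s, hs, a, ha⟩ := exists_smul_eq_of_surjective_baseChange φ.toLinearMap hφ.2 b
  have ha' : s • b = φ a := ha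
  apply smul_right_injective N hs
  change s • f (b • m) = s • b • f m
  rw [← f_smul, ← smul_assoc, ← smul_assoc, ha', hf]
end

section
/- Let A be a commutative ring, I ⊆ A an ideal, A' a commutative A-algebra that is flat as an A-module, and I' ⊆ A' the ideal generated by the image of I. Then the natural A'-algebra homomorphism A' ⊗_A DNC_I(A) → A'[ħ, ħ⁻¹] is injective with image exactly DNC_{I'}(A'); in particular it induces a canonical isomorphism of A'-algebras A' ⊗_A DNC_I(A) ≅ DNC_{I'}(A'). -/
set_option synthInstance.maxHeartbeats 400000
set_option maxHeartbeats 800000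

open scoped TensorProduct

/-- The deformation to the normal cone `DNC_I(A)` of a commutative ring `A` along an ideal
`I ⊆ A`: the `A`-subalgebra of the Laurent polynomial ring `A[ħ, ħ⁻¹]` generated by `A[ħ]`
(i.e. by `ħ`) together with the elements `ħ⁻¹ · f` for `f ∈ I`. -/
noncomputable def DNC (A : Type*) [CommRing A] (I : Ideal A) :
    Subalgebra A (LaurentPolynomial A) :=
  Algebra.adjoin A
    ({LaurentPolynomial.T 1} ∪
      {x | ∃ f ∈ I, x = LaurentPolynomial.C f * LaurentPolynomial.T (-1)})

lemma C_mul_mem_DNC {A : Type*} [CommRing A] {I : Ideal A} (a : A) {p : LaurentPolynomial A}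
    (hp : p ∈ DNC A I) : LaurentPolynomial.C a * p ∈ DNC A I := by
  rw [← LaurentPolynomial.smul_eq_C_mul]
  exact (DNC A I).smul_mem hp a

lemma T_one_mem_DNC {A : Type*} [CommRing A] (I : Ideal A) :
    LaurentPolynomial.T 1 ∈ DNC A I :=
  Algebra.subset_adjoin (Or.inl rfl)

lemma C_mul_T_neg_one_mem_DNC {A : Type*} [CommRing A] {I : Ideal A} {f : A} (hf : f ∈ I) :
    LaurentPolynomial.C f * LaurentPolynomial.T (-1) ∈ DNC A I :=
  Algebra.subset_adjoin (Or.inr ⟨f, hf, rfl⟩)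

/-- The natural map `A' ⊗[A] A[ħ, ħ⁻¹] → A'[ħ, ħ⁻¹]` is injective. -/
lemma injective_of_tmul_eq_C_mul {A A' : Type*} [CommRing A] [CommRing A'] [Algebra A A']
    (θ : LaurentPolynomial A →+* LaurentPolynomial A')
    (hθC : ∀ a : A, θ (LaurentPolynomial.C a) = LaurentPolynomial.C (algebraMap A A' a))
    (hθT : ∀ n : ℤ, θ (LaurentPolynomial.T n) = LaurentPolynomial.T n)
    (Ψ : A' ⊗[A] LaurentPolynomial A →ₗ[A] LaurentPolynomial A')
    (hΨ : ∀ x p, Ψ (x ⊗ₜ[A] p) = LaurentPolynomial.C x * θ p) :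
    Function.Injective Ψ := by
  let g := (AddMonoidAlgebra.scalarTensorEquiv A A' (M := ℤ)).symm
  have hg (x : A') (n : ℤ) :
      g (LaurentPolynomial.C x * LaurentPolynomial.T n) = x ⊗ₜ LaurentPolynomial.T n := by
    rw [← LaurentPolynomial.single_eq_C_mul_T]
    exact AddMonoidAlgebra.scalarTensorEquiv_symm_single n x
  refine Function.LeftInverse.injective (g := g) fun z ↦ ?_
  induction z with
  | zero => simp
  | add z w hz hw => rw [map_add, map_add, hz, hw]
  | tmul x p =>
    induction p using LaurentPolynomial.induction_on' with
    | add p q hp hq => rw [TensorProduct.tmul_add, map_add, map_add, hp, hq]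
    | C_mul_T n a =>
      rw [hΨ, map_mul θ, hθC, hθT, ← mul_assoc, ← map_mul LaurentPolynomial.C, hg,
        ← LaurentPolynomial.smul_eq_C_mul, TensorProduct.tmul_smul, TensorProduct.smul_tmul',
        Algebra.smul_def, mul_comm]

/-- **Lemma 2.4.** Let `A` be a commutative ring, `I ⊆ A` an ideal, `A'` a commutative
`A`-algebra which is flat as an `A`-module, and `I' ⊆ A'` the ideal generated by the image
of `I`.  Then the natural `A'`-algebra homomorphism
`A' ⊗[A] DNC_I(A) → A'[ħ, ħ⁻¹]` (here `θ` is the coefficient-wise extension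
`A[ħ, ħ⁻¹] → A'[ħ, ħ⁻¹]` of `algebraMap A A'`, and `Φ` is the map determined by
`x ⊗ y ↦ C x · θ y`) is injective with image exactly `DNC_{I'}(A')`; in particular it
induces a canonical isomorphism `A' ⊗[A] DNC_I(A) ≅ DNC_{I'}(A')`. -/
theorem stmt1 (A : Type*) [CommRing A] (I : Ideal A)
    (A' : Type*) [CommRing A'] [Algebra A A'] [Module.Flat A A']
    (I' : Ideal A') (hI' : I' = I.map (algebraMap A A'))
    (θ : LaurentPolynomial A →+* LaurentPolynomial A')
    (hθC : ∀ a : A, θ (LaurentPolynomial.C a) = LaurentPolynomial.C (algebraMap A A' a))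
    (hθT : ∀ n : ℤ, θ (LaurentPolynomial.T n) = LaurentPolynomial.T n)
    (Φ : A' ⊗[A] ↥(DNC A I) →ₗ[A] LaurentPolynomial A')
    (hΦ : ∀ (x : A') (y : ↥(DNC A I)),
      Φ (x ⊗ₜ[A] y) = LaurentPolynomial.C x * θ (y : LaurentPolynomial A)) :
    Function.Injective Φ ∧
      Set.range ⇑Φ = (DNC A' I' : Set (LaurentPolynomial A')) := by
  have hθ (a : A) (p : LaurentPolynomial A) : θ (a • p) = a • θ p := by
    rw [LaurentPolynomial.smul_eq_C_mul, map_mul, hθC, ← LaurentPolynomial.smul_eq_C_mul,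
      algebraMap_smul]
  constructor
  · let Ψ : A' ⊗[A] LaurentPolynomial A →ₗ[A] LaurentPolynomial A' :=
      TensorProduct.lift (LinearMap.mk₂ A (fun x p ↦ LaurentPolynomial.C x * θ p)
        (fun x y p ↦ by rw [map_add, add_mul])
        (fun a x p ↦ by
          rw [← LaurentPolynomial.smul_eq_C_mul, ← LaurentPolynomial.smul_eq_C_mul, smul_assoc])
        (fun x p q ↦ by rw [map_add, mul_add])
        (fun a x p ↦ by rw [hθ, mul_smul_comm]))
    have hΨ : Function.Injective Ψ :=
      injective_of_tmul_eq_C_mul θ hθC hθT Ψ fun x p ↦ by simp [Ψ]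
    have hΦΨ : Φ = Ψ ∘ₗ (DNC A I).toSubmodule.subtype.lTensor A' :=
      TensorProduct.ext' fun x y ↦ by
        rw [hΦ]
        simp [Ψ]
    rw [hΦΨ]
    exact hΨ.comp
      (Module.Flat.lTensor_preserves_injective_linearMap _ (Submodule.injective_subtype _))
  · subst hI'
    have hΦmul (z w) : Φ (z * w) = Φ z * Φ w := by
      induction z with
      | zero => simp
      | add z₁ z₂ h₁ h₂ => rw [add_mul, map_add, h₁, h₂, map_add, add_mul]
      | tmul x p =>
        induction w with
        | zero => simp
        | add w₁ w₂ h₁ h₂ => rw [mul_add, map_add, h₁, h₂, map_add, mul_add]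
        | tmul y q =>
          rw [Algebra.TensorProduct.tmul_mul_tmul, hΦ, hΦ, hΦ, map_mul, MulMemClass.coe_mul,
            map_mul, mul_mul_mul_comm]
    refine Set.Subset.antisymm ?_ fun p hp ↦ ?_
    · have hθmem (p : LaurentPolynomial A) (hp : p ∈ DNC A I) :
          θ p ∈ DNC A' (I.map (algebraMap A A')) := by
        induction hp using Algebra.adjoin_induction with
        | mem p hp =>
          rcases hp with rfl | ⟨f, hf, rfl⟩
          · rw [hθT]
            exact T_one_mem_DNC _
          · rw [map_mul, hθC, hθT]
            exact C_mul_T_neg_one_mem_DNC (Ideal.mem_map_of_mem _ hf)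
        | algebraMap a =>
          rw [← LaurentPolynomial.C_eq_algebraMap, hθC, LaurentPolynomial.C_eq_algebraMap]
          exact Subalgebra.algebraMap_mem _ _
        | add p q _ _ hp hq => rw [map_add]; exact add_mem hp hq
        | mul p q _ _ hp hq => rw [map_mul]; exact mul_mem hp hq
      rintro _ ⟨z, rfl⟩
      induction z with
      | zero => rw [map_zero]; exact zero_mem _
      | add z w hz hw => rw [map_add]; exact add_mem hz hw
      | tmul x p => rw [hΦ]; exact C_mul_mem_DNC x (hθmem p p.2)
    · induction hp using Algebra.adjoin_induction with
      | mem p hp =>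
        rcases hp with rfl | ⟨f, hf, rfl⟩
        · exact ⟨1 ⊗ₜ ⟨_, T_one_mem_DNC I⟩, by rw [hΦ, hθT, map_one, one_mul]⟩
        · induction hf using Submodule.span_induction with
          | zero => exact ⟨0, by simp⟩
          | mem f hf =>
            obtain ⟨a, ha, rfl⟩ := hf
            exact ⟨1 ⊗ₜ ⟨_, C_mul_T_neg_one_mem_DNC ha⟩, by
              rw [hΦ, map_mul, hθC, hθT, map_one, one_mul]⟩
          | add f g _ _ hf hg =>
            obtain ⟨z, hz⟩ := hf
            obtain ⟨w, hw⟩ := hg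
            exact ⟨z + w, by rw [map_add, hz, hw, map_add, add_mul]⟩
          | smul x f _ hf =>
            obtain ⟨z, hz⟩ := hf
            exact ⟨x ⊗ₜ 1 * z, by
              rw [hΦmul, hz, hΦ, OneMemClass.coe_one, map_one, mul_one, smul_eq_mul, map_mul,
                mul_assoc]⟩
      | algebraMap x =>
        exact ⟨x ⊗ₜ 1, by
          rw [hΦ, OneMemClass.coe_one, map_one, mul_one, LaurentPolynomial.C_eq_algebraMap]⟩
      | add p q _ _ hp hq =>
        obtain ⟨z, rfl⟩ := hp
        obtain ⟨w, rfl⟩ := hq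
        exact ⟨z + w, map_add _ _ _⟩
      | mul p q _ _ hp hq =>
        obtain ⟨z, rfl⟩ := hp
        obtain ⟨w, rfl⟩ := hq
        exact ⟨z * w, hΦmul _ _⟩
end

section
/- Let k be a commutative ring, and let M = ⊕_{i∈ℤ} M_i and N = ⊕_{i∈ℤ} N_i be ℤ-graded k-modules all of whose graded components M_i and N_i are finite free k-modules with rank_k M_i = rank_k N_i for every i. Let φ : M → N be a degree-preserving k-linear map such that for every algebraically closed field F and every ring homomorphism k → F the induced map F ⊗_k M → F ⊗_k N is injective. Then φ is an isomorphism. -/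
open scoped TensorProduct DirectSum

/-- An endomorphism of a finite free module is bijective if its base change to every
algebraically closed field is injective. -/
theorem LinearMap.bijective_of_forall_injective_baseChange {k M : Type} [CommRing k]
    [AddCommGroup M] [Module k M] [Module.Free k M] [Module.Finite k M] (f : M →ₗ[k] M)
    (hf : ∀ (F : Type) [Field F] [IsAlgClosed F] [Algebra k F],
      Function.Injective (f.baseChange F)) :
    Function.Bijective f := by
  rw [← Module.End.isUnit_iff, LinearMap.isUnit_iff_isUnit_det]
  by_contra hdet
  obtain ⟨m, hm, hmem⟩ := exists_max_ideal_of_mem_nonunits hdet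
  let : Field (k ⧸ m) := Ideal.Quotient.field m
  let F := AlgebraicClosure (k ⧸ m)
  let : Algebra k F := ((algebraMap (k ⧸ m) F).comp (Ideal.Quotient.mk m)).toAlgebra
  have hunit : IsUnit (f.baseChange F) := by
    rw [LinearMap.isUnit_iff_ker_eq_bot, LinearMap.ker_eq_bot]
    exact hf F
  rw [LinearMap.isUnit_iff_isUnit_det, LinearMap.det_baseChange] at hunit
  refine hunit.ne_zero ?_
  change algebraMap (k ⧸ m) F (Ideal.Quotient.mk m (LinearMap.det f)) = 0
  rw [Ideal.Quotient.eq_zero_iff_mem.mpr hmem, map_zero]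

/-- If the base change of a direct sum of linear maps is injective, then so is the base change
of each summand. -/
theorem LinearMap.injective_baseChange_of_dfinsupp {k F ι : Type*} [CommRing k] [CommRing F]
    [Algebra k F] [DecidableEq ι] {M N : ι → Type*} [∀ i, AddCommGroup (M i)]
    [∀ i, Module k (M i)] [∀ i, AddCommGroup (N i)] [∀ i, Module k (N i)]
    (φ : ∀ i, M i →ₗ[k] N i)
    (h : Function.Injective (LinearMap.baseChange F
      (DFinsupp.mapRange.linearMap φ : (Π₀ i, M i) →ₗ[k] Π₀ i, N i))) (i : ι) :
    Function.Injective ((φ i).baseChange F) := by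
  have hcomm : (DFinsupp.mapRange.linearMap φ) ∘ₗ DFinsupp.lsingle (R := k) i =
      DFinsupp.lsingle (R := k) i ∘ₗ φ i := by
    ext x : 1
    simp
  have hretr : DFinsupp.lapply (R := k) i ∘ₗ DFinsupp.lsingle (R := k) (M := M) i =
      LinearMap.id := by
    ext x : 1
    simp
  have hsingle : Function.Injective
      (LinearMap.baseChange F (DFinsupp.lsingle (R := k) (M := M) i)) := by
    refine Function.LeftInverse.injective
      (g := LinearMap.baseChange F (DFinsupp.lapply (R := k) (M := M) i)) fun x => ?_
    rw [← LinearMap.comp_apply, ← LinearMap.baseChange_comp, hretr, LinearMap.baseChange_id,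
      LinearMap.id_apply]
  have hcomp := h.comp hsingle
  rw [← LinearMap.coe_comp, ← LinearMap.baseChange_comp, hcomm, LinearMap.baseChange_comp,
    LinearMap.coe_comp] at hcomp
  exact hcomp.of_comp

/-- **Lemma 2.6.** Let `k` be a commutative ring, and let `M = ⊕ᵢ Mᵢ` and `N = ⊕ᵢ Nᵢ` be
`ℤ`-graded `k`-modules all of whose graded components are finite free `k`-modules with
`rk Mᵢ = rk Nᵢ` for every `i`.  Let `φ : M → N` be a degree-preserving `k`-linear map
(i.e. a family of maps `φᵢ : Mᵢ → Nᵢ`) such that for every algebraically closed field `F`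
and every ring homomorphism `k → F` the induced map `F ⊗[k] M → F ⊗[k] N` is injective.
Then `φ` is an isomorphism. -/
theorem stmt3 (k : Type) [CommRing k]
    (M N : ℤ → Type) [∀ i, AddCommGroup (M i)] [∀ i, Module k (M i)]
    [∀ i, AddCommGroup (N i)] [∀ i, Module k (N i)]
    [∀ i, Module.Free k (M i)] [∀ i, Module.Finite k (M i)]
    [∀ i, Module.Free k (N i)] [∀ i, Module.Finite k (N i)]
    (hrank : ∀ i, Module.finrank k (M i) = Module.finrank k (N i))
    (φ : ∀ i, M i →ₗ[k] N i)
    (hinj : ∀ (F : Type) [Field F] [IsAlgClosed F] (g : k →+* F),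
      letI : Algebra k F := g.toAlgebra
      Function.Injective
        (LinearMap.baseChange F
          (DFinsupp.mapRange.linearMap φ : (Π₀ i, M i) →ₗ[k] Π₀ i, N i))) :
    ∀ i, Function.Bijective (φ i) := by
  intro i
  cases subsingleton_or_nontrivial k with
  | inl _ =>
    have := Module.subsingleton k (M i)
    have := Module.subsingleton k (N i)
    exact ⟨Function.injective_of_subsingleton _, fun y => ⟨0, Subsingleton.elim _ _⟩⟩
  | inr _ =>
    let e : M i ≃ₗ[k] N i := LinearEquiv.ofFinrankEq _ _ (hrank i)
    have hbij : Function.Bijective (e.symm.toLinearMap ∘ₗ φ i) := by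
      refine LinearMap.bijective_of_forall_injective_baseChange _ fun F _ _ inst => ?_
      have hF := hinj F (algebraMap k F)
      have halg : (algebraMap k F).toAlgebra = inst := Algebra.algebra_ext _ _ fun _ => rfl
      rw [halg] at hF
      rw [LinearMap.baseChange_comp, LinearMap.coe_comp]
      exact (e.symm.baseChange k F _ _).injective.comp
        (LinearMap.injective_baseChange_of_dfinsupp φ hF i)
    rw [LinearMap.coe_comp] at hbij
    exact (e.symm.bijective.of_comp_iff' _).mp hbij
end

section
/- Let R be a commutative ring, A an R-algebra isomorphic to a polynomial algebra in finitely many variables over R, and B a commutative A-algebra that is flat as an A-module. Let I₂ ⊆ A ⊗_R B be the ideal generated by the elements a⊗1 − 1⊗ā for a ∈ A (where ā denotes the image of a in B), and let I₃ ⊆ B ⊗_R B be the ideal generated by the elements ā⊗1 − 1⊗ā for a ∈ A. Set C_ħ := DNC_{I₂}(A ⊗_R B) and C̃_ħ := DNC_{I₃}(B ⊗_R B). Then: (i) the R[ħ]-algebra homomorphism A[ħ] → C_ħ induced by the first tensor factor and the homomorphism B[ħ] → C_ħ induced by the second tensor factor are both flat; (ii) the two R[ħ]-algebra homomorphisms B[ħ]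 → C̃_ħ induced by the two tensor factors are both flat; (iii) there are canonical isomorphisms C_ħ ≅ (A ⊗_R B) ⊗_{A ⊗_R A} DNC_{I₁}(A ⊗_R A) and C̃_ħ ≅ (B ⊗_R B) ⊗_{A ⊗_R B} C_ħ, where I₁ ⊆ A ⊗_R A is the ideal generated by the elements a⊗1 − 1⊗a for a ∈ A. -/
set_option synthInstance.maxHeartbeats 1000000
set_option maxHeartbeats 1600000

open scoped TensorProduct

namespace DNC

open LaurentPolynomial

section BaseChange

variable {P Q : Type*} [CommRing P] [CommRing Q] [Algebra P Q] (J : Ideal P)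

/-- The canonical map `Q ⊗[P] DNC_J(P) → Q[ħ, ħ⁻¹]`. -/
noncomputable def baseChangeHom : Q ⊗[P] DNC P J →ₐ[Q] LaurentPolynomial Q :=
  (AddMonoidAlgebra.scalarTensorEquiv P Q (M := ℤ)).toAlgHom.comp
    (Algebra.TensorProduct.map (AlgHom.id Q Q) (DNC P J).val)

theorem T_one_mem : T 1 ∈ DNC P J :=
  Algebra.subset_adjoin (Or.inl rfl)

theorem C_mem (p : P) : C p ∈ DNC P J :=
  (DNC P J).algebraMap_mem p

variable {J} in
theorem C_mul_T_mem {p : P} (hp : p ∈ J) : C p * T (-1) ∈ DNC P J :=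
  Algebra.subset_adjoin (Or.inr ⟨p, hp, rfl⟩)

theorem baseChangeHom_tmul (x : Q) (y : DNC P J) :
    baseChangeHom J (x ⊗ₜ[P] y) =
      C x * AddMonoidAlgebra.mapAlgHom ℤ (Algebra.ofId P Q) (y : LaurentPolynomial P) := by
  simp [baseChangeHom, ← smul_eq_C_mul]

theorem mapAlgHom_C (p : P) :
    AddMonoidAlgebra.mapAlgHom ℤ (Algebra.ofId P Q) (C p) = C (algebraMap P Q p) := by
  rw [← single_eq_C, ← single_eq_C]
  simp [Algebra.ofId_apply, -single_eq_C_mul_T]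

theorem mapAlgHom_T (m : ℤ) :
    AddMonoidAlgebra.mapAlgHom ℤ (Algebra.ofId P Q) (T m) = T m := by
  simp [T, -single_eq_C_mul_T]

theorem baseChangeHom_injective [Module.Flat P Q] :
    Function.Injective (baseChangeHom J : Q ⊗[P] DNC P J →ₐ[Q] LaurentPolynomial Q) := by
  have h := Module.Flat.lTensor_preserves_injective_linearMap (M := Q)
    (DNC P J).val.toLinearMap Subtype.val_injective
  exact (AddMonoidAlgebra.scalarTensorEquiv P Q (M := ℤ)).injective.comp h

theorem range_baseChangeHom :
    (baseChangeHom J : Q ⊗[P] DNC P J →ₐ[Q] LaurentPolynomial Q).range =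
      DNC Q (J.map (algebraMap P Q)) := by
  apply le_antisymm
  · rintro _ ⟨z, rfl⟩
    change baseChangeHom J z ∈ _
    induction z using TensorProduct.induction_on with
    | zero => rw [map_zero]; exact zero_mem _
    | add a b ha hb => rw [map_add]; exact add_mem ha hb
    | tmul x y =>
      rw [baseChangeHom_tmul]
      refine mul_mem (C_mem _ x) ?_
      have key : DNC P J ≤ ((DNC Q (J.map (algebraMap P Q))).restrictScalars P).comap
          (AddMonoidAlgebra.mapAlgHom ℤ (Algebra.ofId P Q)) := by
        refine Algebra.adjoin_le ?_
        rintro _ (rfl | ⟨f, hf, rfl⟩)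
        · change AddMonoidAlgebra.mapAlgHom ℤ (Algebra.ofId P Q) (T 1) ∈ DNC Q _
          rw [mapAlgHom_T]
          exact T_one_mem _
        · change AddMonoidAlgebra.mapAlgHom ℤ (Algebra.ofId P Q) (C f * T (-1)) ∈ DNC Q _
          rw [map_mul, mapAlgHom_T, mapAlgHom_C]
          exact C_mul_T_mem (Ideal.mem_map_of_mem _ hf)
      exact key y.2
  · refine Algebra.adjoin_le ?_
    rintro _ (rfl | ⟨f, hf, rfl⟩)
    · exact ⟨1 ⊗ₜ ⟨T 1, T_one_mem J⟩, by
        change baseChangeHom J _ = _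
        simp [baseChangeHom_tmul, mapAlgHom_T]⟩
    · refine Submodule.span_induction ?_ ?_ ?_ ?_ hf
      · rintro _ ⟨p, hp, rfl⟩
        exact ⟨1 ⊗ₜ ⟨C p * T (-1), C_mul_T_mem hp⟩, by
          change baseChangeHom J _ = _
          rw [baseChangeHom_tmul, map_mul, mapAlgHom_T, mapAlgHom_C]
          simp⟩
      · rw [map_zero, zero_mul]
        exact zero_mem _
      · intro x y _ _ hx hy
        rw [map_add, add_mul]
        exact add_mem hx hy
      · intro a x _ hx
        rw [smul_eq_mul, map_mul, mul_assoc]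
        exact mul_mem ((baseChangeHom J).range.algebraMap_mem a) hx

theorem injective_and_range_of_tmul [Module.Flat P Q] {K : Ideal Q}
    (hK : J.map (algebraMap P Q) = K)
    (θ : LaurentPolynomial P →+* LaurentPolynomial Q)
    (hC : ∀ x, θ (C x) = C (algebraMap P Q x)) (hT : ∀ m, θ (T m) = T m)
    (Φ : Q ⊗[P] DNC P J →+ LaurentPolynomial Q)
    (hΦ : ∀ x (y : DNC P J), Φ (x ⊗ₜ[P] y) = C x * θ y) :
    Function.Injective Φ ∧ Set.range Φ = (DNC Q K : Set (LaurentPolynomial Q)) := by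
  have hθ (q : LaurentPolynomial P) :
      θ q = AddMonoidAlgebra.mapAlgHom ℤ (Algebra.ofId P Q) q := by
    induction q using LaurentPolynomial.induction_on' with
    | add p q hp hq => rw [map_add, map_add, hp, hq]
    | C_mul_T n a => rw [map_mul, map_mul, hC, hT, mapAlgHom_C, mapAlgHom_T]
  have h : (Φ : Q ⊗[P] DNC P J → LaurentPolynomial Q) = baseChangeHom J := by
    funext z
    induction z using TensorProduct.induction_on with
    | zero => rw [map_zero, map_zero]
    | add a b ha hb => rw [map_add, map_add, ha, hb]
    | tmul x y => rw [hΦ, baseChangeHom_tmul, hθ]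
  rw [h, ← hK, ← range_baseChangeHom]
  exact ⟨baseChangeHom_injective J, rfl⟩

theorem flat_includeRight {D : Type*} [CommRing D] [Algebra P D] [Module.Flat P Q] :
    (Algebra.TensorProduct.includeRight : D →ₐ[P] Q ⊗[P] D).toRingHom.Flat := by
  have h : (algebraMap D (D ⊗[P] Q)).Flat := RingHom.flat_algebraMap_iff.mpr inferInstance
  exact h.comp (.of_bijective (Algebra.TensorProduct.comm P D Q).bijective)

/-- If `Q` is flat over `P`, then so is `DNC_{JQ}(Q)` over `DNC_J(P)`. -/
theorem exists_flat_ringHom [Module.Flat P Q] :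
    ∃ g : DNC P J →+* DNC Q (J.map (algebraMap P Q)), g.Flat ∧
      ∀ y, (g y : LaurentPolynomial Q) =
        AddMonoidAlgebra.mapAlgHom ℤ (Algebra.ofId P Q) (y : LaurentPolynomial P) := by
  let e := (AlgEquiv.ofInjective (baseChangeHom J) (baseChangeHom_injective (Q := Q) J)).trans
    (Subalgebra.equivOfEq _ _ (range_baseChangeHom J))
  let i : DNC P J →ₐ[P] Q ⊗[P] DNC P J := Algebra.TensorProduct.includeRight
  have hi : i.toRingHom.Flat := flat_includeRight
  refine ⟨e.toRingEquiv.toRingHom.comp i.toRingHom, hi.comp (.of_bijective e.bijective), ?_⟩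
  intro y
  change baseChangeHom J (1 ⊗ₜ y) = _
  simp [baseChangeHom_tmul]

end BaseChange

section Polynomial

variable {S P : Type*} [CommRing S] [CommRing P] {σ : Type*}

/-- The map `S[ħ][zᵢ] → P[ħ, ħ⁻¹]` sending `zᵢ` to `ħ⁻¹ yᵢ`, where `yᵢ = e Xᵢ`. -/
noncomputable def rescaleHom (e : MvPolynomial σ S ≃+* P) :
    MvPolynomial σ (Polynomial S) →+* LaurentPolynomial P :=
  MvPolynomial.eval₂Hom
    (Polynomial.eval₂RingHom (C.comp (e.toRingHom.comp MvPolynomial.C)) (T 1))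
    (fun i ↦ C (e (MvPolynomial.X i)) * T (-1))

theorem rescaleHom_injective (e : MvPolynomial σ S ≃+* P) :
    Function.Injective (rescaleHom e) := by
  let u : (LaurentPolynomial (MvPolynomial σ S))ˣ :=
    ⟨T 1, T (-1), by rw [← T_add]; simp, by rw [← T_add]; simp⟩
  let g : LaurentPolynomial P →+* LaurentPolynomial (MvPolynomial σ S) :=
    eval₂ ((MvPolynomial.eval₂Hom (C.comp MvPolynomial.C)
      (fun i ↦ C (MvPolynomial.X i) * T 1)).comp e.symm.toRingHom) u
  have hcomp : g.comp (rescaleHom e) = Polynomial.toLaurent.comp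
      (MvPolynomial.eval₂Hom (Polynomial.mapRingHom MvPolynomial.C)
        (fun i ↦ Polynomial.C (MvPolynomial.X i))) := by
    refine MvPolynomial.ringHom_ext' (Polynomial.ringHom_ext (fun s ↦ ?_) ?_) fun i ↦ ?_
    · simp [g, rescaleHom]
    · have hu : g (T 1) = T 1 := (eval₂_T_n _ u 1).trans (pow_one _)
      simp [rescaleHom, hu]
    · have hu : g (T (-1)) = T (-1) := (eval₂_T_neg_n _ u 1).trans (pow_one _)
      have hX : g (C (e (MvPolynomial.X i))) = C (MvPolynomial.X i) * T 1 := by simp [g]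
      simp only [rescaleHom, RingHom.comp_apply, MvPolynomial.coe_eval₂Hom, MvPolynomial.eval₂_X,
        map_mul, hu, hX, Polynomial.toLaurent_C]
      rw [mul_assoc, ← T_add, add_neg_cancel, T_zero, mul_one]
  let k : Polynomial (MvPolynomial σ S) →+* MvPolynomial σ (Polynomial S) :=
    Polynomial.eval₂RingHom (MvPolynomial.map Polynomial.C) (MvPolynomial.C Polynomial.X)
  have hk : k.comp (MvPolynomial.eval₂Hom (Polynomial.mapRingHom MvPolynomial.C)
      (fun i ↦ Polynomial.C (MvPolynomial.X i))) = RingHom.id _ := by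
    refine MvPolynomial.ringHom_ext' (Polynomial.ringHom_ext (fun s ↦ ?_) ?_) fun i ↦ ?_ <;>
      simp [k]
  have hinj := Polynomial.toLaurent_injective.comp
    (Function.LeftInverse.injective (DFunLike.congr_fun hk))
  exact Function.Injective.of_comp (f := g) (by
    simpa only [← RingHom.coe_comp, hcomp] using hinj)

theorem range_rescaleHom (e : MvPolynomial σ S ≃+* P) :
    ((rescaleHom e).range : Set (LaurentPolynomial P)) =
      DNC P (Ideal.span (Set.range fun i ↦ e (MvPolynomial.X i))) := by
  have hT : T 1 ∈ (rescaleHom e).range := ⟨MvPolynomial.C Polynomial.X, by simp [rescaleHom]⟩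
  have hX (i : σ) : C (e (MvPolynomial.X i)) * T (-1) ∈ (rescaleHom e).range :=
    ⟨MvPolynomial.X i, by simp [rescaleHom]⟩
  have hC (p : P) : C p ∈ (rescaleHom e).range := by
    obtain ⟨q, rfl⟩ := e.surjective p
    induction q using MvPolynomial.induction_on with
    | C s => exact ⟨MvPolynomial.C (Polynomial.C s), by simp [rescaleHom]⟩
    | add p q hp hq => rw [map_add, map_add]; exact add_mem hp hq
    | mul_X p i hp =>
      rw [map_mul, map_mul]
      refine mul_mem hp ?_
      have := mul_mem (hX i) hT
      rwa [mul_assoc, ← T_add, neg_add_cancel, T_zero, mul_one] at this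
  apply Set.Subset.antisymm
  · rintro _ ⟨q, rfl⟩
    induction q using MvPolynomial.induction_on with
    | C s =>
      induction s using Polynomial.induction_on' with
      | add p q hp hq => rw [map_add, map_add]; exact add_mem hp hq
      | monomial n a =>
        simp only [rescaleHom, MvPolynomial.coe_eval₂Hom, MvPolynomial.eval₂_C,
          Polynomial.coe_eval₂RingHom, Polynomial.eval₂_monomial]
        exact mul_mem (C_mem _ _) (pow_mem (T_one_mem _) n)
    | add p q hp hq => rw [map_add]; exact add_mem hp hq
    | mul_X p i hp =>
      rw [map_mul]
      refine mul_mem hp ?_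
      have : C (e (MvPolynomial.X i)) * T (-1) ∈
          DNC P (Ideal.span (Set.range fun i ↦ e (MvPolynomial.X i))) :=
        C_mul_T_mem (Ideal.subset_span ⟨i, rfl⟩)
      simpa [rescaleHom] using this
  · intro x hx
    refine Algebra.adjoin_induction (fun y hy ↦ ?_) (fun p ↦ hC p)
      (fun _ _ _ _ hx hy ↦ add_mem hx hy) (fun _ _ _ _ hx hy ↦ mul_mem hx hy) hx
    obtain (rfl | ⟨f, hf, rfl⟩) := hy
    · exact hT
    · refine Submodule.span_induction ?_ ?_ ?_ ?_ hf
      · rintro _ ⟨i, rfl⟩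
        exact hX i
      · rw [map_zero, zero_mul]
        exact zero_mem _
      · intro x y _ _ hx hy
        rw [map_add, add_mul]
        exact add_mem hx hy
      · intro a x _ hx
        rw [smul_eq_mul, map_mul, mul_assoc]
        exact mul_mem (hC a) hx

/-- For `P = S[yᵢ]` and `J = (yᵢ)`, the ring `DNC_J(P)` is a polynomial ring over `S[ħ]`. -/
theorem exists_flat_polynomial (e : MvPolynomial σ S ≃+* P) {J : Ideal P}
    (hJ : J = Ideal.span (Set.range fun i ↦ e (MvPolynomial.X i))) :
    ∃ ψ : Polynomial S →+* DNC P J, ψ.Flat ∧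
      (∀ s, (ψ (Polynomial.C s) : LaurentPolynomial P) = C (e (MvPolynomial.C s))) ∧
      (ψ Polynomial.X : LaurentPolynomial P) = T 1 := by
  subst hJ
  have hmem (q) : rescaleHom e q ∈
      DNC P (Ideal.span (Set.range fun i ↦ e (MvPolynomial.X i))) := by
    rw [← SetLike.mem_coe, ← range_rescaleHom]
    exact ⟨q, rfl⟩
  let f := (rescaleHom e).codRestrict _ hmem
  have hf : Function.Bijective f := by
    refine ⟨fun a b h ↦ rescaleHom_injective e (congrArg Subtype.val h), fun y ↦ ?_⟩
    have hy := y.2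
    rw [← SetLike.mem_coe, ← range_rescaleHom] at hy
    obtain ⟨q, hq⟩ := hy
    exact ⟨q, Subtype.ext hq⟩
  have hflat : (MvPolynomial.C : Polynomial S →+* MvPolynomial σ (Polynomial S)).Flat :=
    RingHom.flat_algebraMap_iff.mpr (inferInstanceAs
      (Module.Flat (Polynomial S) (MvPolynomial σ (Polynomial S))))
  refine ⟨f.comp MvPolynomial.C, hflat.comp (.of_bijective hf), fun s ↦ ?_, ?_⟩
  · simp [f, rescaleHom]
  · simp [f, rescaleHom]

theorem flat_of_polynomial {Q : Type*} [CommRing Q] [Algebra P Q] [Module.Flat P Q]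
    (e : MvPolynomial σ S ≃+* P) {J : Ideal P}
    (hJ : J = Ideal.span (Set.range fun i ↦ e (MvPolynomial.X i)))
    {K : Ideal Q} (hK : J.map (algebraMap P Q) = K)
    (ψ : Polynomial S →+* DNC Q K)
    (hC : ∀ s, (ψ (Polynomial.C s) : LaurentPolynomial Q) =
      C (algebraMap P Q (e (MvPolynomial.C s))))
    (hX : (ψ Polynomial.X : LaurentPolynomial Q) = T 1) : ψ.Flat := by
  subst hK
  obtain ⟨χ, hχ, hχC, hχX⟩ := exists_flat_polynomial e hJ
  obtain ⟨g, hg, hgy⟩ := exists_flat_ringHom (Q := Q) J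
  have : ψ = g.comp χ := by
    refine Polynomial.ringHom_ext (fun s ↦ Subtype.ext ?_) (Subtype.ext ?_)
    · simp [hC, hgy, hχC, mapAlgHom_C]
    · simp [hX, hgy, hχX, mapAlgHom_T]
  exact this ▸ hχ.comp hg

end Polynomial

section Diagonal

theorem map_span_eq {X P Q : Type*} [CommRing P] [CommRing Q] (f : P →+* Q) (g : X → P)
    (h : X → Q) (hgh : ∀ a, f (g a) = h a) :
    (Ideal.span {x | ∃ a, x = g a}).map f = Ideal.span {x | ∃ a, x = h a} := by
  rw [Ideal.map_span]
  congr 1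
  ext x
  simp [← hgh, eq_comm]

variable {R A S : Type*} [CommRing R] [CommRing A] [Algebra R A] [CommRing S] [Algebra R S]
  {σ : Type*}

/-- If `A = R[xᵢ]`, then `S ⊗[R] A` is a polynomial ring over `S` in the variables
`u xᵢ ⊗ 1 - 1 ⊗ xᵢ`. -/
theorem exists_mvPolynomial_equiv_left (ρ : MvPolynomial σ R ≃ₐ[R] A) (u : A →ₐ[R] S) :
    ∃ e : MvPolynomial σ S ≃+* S ⊗[R] A, (∀ s, e (MvPolynomial.C s) = s ⊗ₜ[R] 1) ∧
      Ideal.span {x | ∃ a : A, x = u a ⊗ₜ[R] (1 : A) - (1 : S) ⊗ₜ[R] a} =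
        Ideal.span (Set.range fun i ↦ e (MvPolynomial.X i)) := by
  let y (i : σ) : S ⊗[R] A :=
    u (ρ (MvPolynomial.X i)) ⊗ₜ[R] 1 - 1 ⊗ₜ[R] ρ (MvPolynomial.X i)
  let f : MvPolynomial σ S →ₐ[S] S ⊗[R] A := MvPolynomial.aeval y
  let v : A →ₐ[R] MvPolynomial σ S :=
    (MvPolynomial.aeval fun i ↦
      MvPolynomial.C (u (ρ (MvPolynomial.X i))) - MvPolynomial.X i).comp ρ.symm.toAlgHom
  let g : S ⊗[R] A →ₐ[S] MvPolynomial σ S :=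
    Algebra.TensorProduct.lift (Algebra.ofId S _) v (fun _ _ ↦ .all _ _)
  have hfg : f.comp g = AlgHom.id S _ := by
    have h : ((f.comp g).restrictScalars R).comp Algebra.TensorProduct.includeRight =
        (Algebra.TensorProduct.includeRight : A →ₐ[R] S ⊗[R] A) := by
      rw [← AlgHom.cancel_right ρ.surjective (f := ρ.toAlgHom)]
      ext i
      simp [f, g, v, y, MvPolynomial.algebraMap_eq, Algebra.TensorProduct.algebraMap_apply]
    ext a
    exact DFunLike.congr_fun h a
  have hgf : g.comp f = AlgHom.id S _ := by
    ext i
    simp [f, g, v, y, MvPolynomial.algebraMap_eq, Algebra.ofId_apply]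
  let e := AlgEquiv.ofAlgHom f g hfg hgf
  have heX (i : σ) : e (MvPolynomial.X i) = y i := MvPolynomial.aeval_X _ _
  refine ⟨e.toRingEquiv, fun s ↦ MvPolynomial.aeval_C _ _, le_antisymm ?_ ?_⟩
  · rw [Ideal.span_le]
    rintro _ ⟨a, rfl⟩
    set I := Ideal.span (Set.range fun i ↦ e.toRingEquiv (MvPolynomial.X i)) with hI
    have h : ((Ideal.Quotient.mkₐ R I).comp
          (Algebra.TensorProduct.includeLeft : S →ₐ[R] S ⊗[R] A)).comp u =
        (Ideal.Quotient.mkₐ R I).comp Algebra.TensorProduct.includeRight := by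
      rw [← AlgHom.cancel_right ρ.surjective (f := ρ.toAlgHom)]
      ext i
      exact Ideal.Quotient.eq.mpr (Ideal.subset_span ⟨i, heX i⟩)
    exact Ideal.Quotient.eq.mp (DFunLike.congr_fun h a)
  · rw [Ideal.span_le]
    rintro _ ⟨i, rfl⟩
    exact Ideal.subset_span ⟨ρ (MvPolynomial.X i), heX i⟩

/-- If `A = R[xᵢ]`, then `A ⊗[R] S` is a polynomial ring over `S` in the variables
`1 ⊗ u xᵢ - xᵢ ⊗ 1`. -/
theorem exists_mvPolynomial_equiv_right (ρ : MvPolynomial σ R ≃ₐ[R] A) (u : A →ₐ[R] S) :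
    ∃ e : MvPolynomial σ S ≃+* A ⊗[R] S, (∀ s, e (MvPolynomial.C s) = 1 ⊗ₜ[R] s) ∧
      Ideal.span {x | ∃ a : A, x = a ⊗ₜ[R] (1 : S) - (1 : A) ⊗ₜ[R] u a} =
        Ideal.span (Set.range fun i ↦ e (MvPolynomial.X i)) := by
  obtain ⟨e, hC, hI⟩ := exists_mvPolynomial_equiv_left ρ u
  let c := Algebra.TensorProduct.comm R S A
  refine ⟨e.trans c.toRingEquiv, fun s ↦ by simp [hC, c], ?_⟩
  have h := congrArg (Ideal.map c.toRingEquiv) hI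
  rw [Ideal.map_span, Ideal.map_span, ← Set.range_comp] at h
  refine Eq.trans ?_ h
  apply le_antisymm <;> rw [Ideal.span_le]
  · rintro _ ⟨a, rfl⟩
    rw [SetLike.mem_coe, ← neg_mem_iff]
    exact Ideal.subset_span ⟨_, ⟨a, rfl⟩, by simp [c]⟩
  · rintro _ ⟨_, ⟨a, rfl⟩, rfl⟩
    rw [SetLike.mem_coe, ← neg_mem_iff]
    exact Ideal.subset_span ⟨a, by simp [c]⟩

end Diagonal

end DNC

theorem stmt6 (R : Type) [CommRing R]
    (A : Type) [CommRing A] [Algebra R A]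
    (hA : ∃ n : ℕ, Nonempty (MvPolynomial (Fin n) R ≃ₐ[R] A))
    (B : Type) [CommRing B] [Algebra R B] [Algebra A B] [IsScalarTower R A B]
    [Module.Flat A B]
    (I₁ : Ideal (A ⊗[R] A))
    (hI₁ : I₁ = Ideal.span {x | ∃ a : A, x = a ⊗ₜ[R] 1 - 1 ⊗ₜ[R] a})
    (I₂ : Ideal (A ⊗[R] B))
    (hI₂ : I₂ = Ideal.span
      {x | ∃ a : A, x = a ⊗ₜ[R] (1 : B) - (1 : A) ⊗ₜ[R] algebraMap A B a})
    (I₃ : Ideal (B ⊗[R] B))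
    (hI₃ : I₃ = Ideal.span
      {x | ∃ a : A, x = algebraMap A B a ⊗ₜ[R] (1 : B) - (1 : B) ⊗ₜ[R] algebraMap A B a}) :
    -- (i) flatness of `A[ħ] → C_ħ` and `B[ħ] → C_ħ`
    (∀ ψ : Polynomial A →+* ↥(DNC (A ⊗[R] B) I₂),
      (∀ a : A, (ψ (Polynomial.C a) : LaurentPolynomial (A ⊗[R] B)) =
        LaurentPolynomial.C (a ⊗ₜ[R] (1 : B))) →
      ((ψ Polynomial.X : LaurentPolynomial (A ⊗[R] B)) = LaurentPolynomial.T 1) →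
      ψ.Flat) ∧
    (∀ ψ : Polynomial B →+* ↥(DNC (A ⊗[R] B) I₂),
      (∀ b : B, (ψ (Polynomial.C b) : LaurentPolynomial (A ⊗[R] B)) =
        LaurentPolynomial.C ((1 : A) ⊗ₜ[R] b)) →
      ((ψ Polynomial.X : LaurentPolynomial (A ⊗[R] B)) = LaurentPolynomial.T 1) →
      ψ.Flat) ∧
    -- (ii) flatness of the two maps `B[ħ] → C̃_ħ`
    (∀ ψ : Polynomial B →+* ↥(DNC (B ⊗[R] B) I₃),
      (∀ b : B, (ψ (Polynomial.C b) : LaurentPolynomial (B ⊗[R] B)) =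
        LaurentPolynomial.C (b ⊗ₜ[R] (1 : B))) →
      ((ψ Polynomial.X : LaurentPolynomial (B ⊗[R] B)) = LaurentPolynomial.T 1) →
      ψ.Flat) ∧
    (∀ ψ : Polynomial B →+* ↥(DNC (B ⊗[R] B) I₃),
      (∀ b : B, (ψ (Polynomial.C b) : LaurentPolynomial (B ⊗[R] B)) =
        LaurentPolynomial.C ((1 : B) ⊗ₜ[R] b)) →
      ((ψ Polynomial.X : LaurentPolynomial (B ⊗[R] B)) = LaurentPolynomial.T 1) →
      ψ.Flat) ∧
    -- (iii) first canonical isomorphism:  C_ħ ≅ (A ⊗[R] B) ⊗[A ⊗[R] A] DNC_{I₁}(A ⊗[R] A)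
    (letI : Algebra (A ⊗[R] A) (A ⊗[R] B) :=
      (Algebra.TensorProduct.map (AlgHom.id R A)
        (IsScalarTower.toAlgHom R A B)).toRingHom.toAlgebra
     ∀ (θ : LaurentPolynomial (A ⊗[R] A) →+* LaurentPolynomial (A ⊗[R] B)),
      (∀ x : A ⊗[R] A,
        θ (LaurentPolynomial.C x) = LaurentPolynomial.C (algebraMap (A ⊗[R] A) (A ⊗[R] B) x)) →
      (∀ m : ℤ, θ (LaurentPolynomial.T m) = LaurentPolynomial.T m) →
      ∀ (Φ : (A ⊗[R] B) ⊗[A ⊗[R] A] ↥(DNC (A ⊗[R] A) I₁) →ₗ[A ⊗[R] A]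
          LaurentPolynomial (A ⊗[R] B)),
      (∀ (x : A ⊗[R] B) (y : ↥(DNC (A ⊗[R] A) I₁)),
        Φ (x ⊗ₜ[A ⊗[R] A] y) = LaurentPolynomial.C x * θ (y : LaurentPolynomial (A ⊗[R] A))) →
      Function.Injective Φ ∧
        Set.range ⇑Φ = (DNC (A ⊗[R] B) I₂ : Set (LaurentPolynomial (A ⊗[R] B)))) ∧
    -- (iii) second canonical isomorphism:  C̃_ħ ≅ (B ⊗[R] B) ⊗[A ⊗[R] B] C_ħ
    (letI : Algebra (A ⊗[R] B) (B ⊗[R] B) :=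
      (Algebra.TensorProduct.map (IsScalarTower.toAlgHom R A B)
        (AlgHom.id R B)).toRingHom.toAlgebra
     ∀ (θ : LaurentPolynomial (A ⊗[R] B) →+* LaurentPolynomial (B ⊗[R] B)),
      (∀ x : A ⊗[R] B,
        θ (LaurentPolynomial.C x) = LaurentPolynomial.C (algebraMap (A ⊗[R] B) (B ⊗[R] B) x)) →
      (∀ m : ℤ, θ (LaurentPolynomial.T m) = LaurentPolynomial.T m) →
      ∀ (Φ : (B ⊗[R] B) ⊗[A ⊗[R] B] ↥(DNC (A ⊗[R] B) I₂) →ₗ[A ⊗[R] B]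
          LaurentPolynomial (B ⊗[R] B)),
      (∀ (x : B ⊗[R] B) (y : ↥(DNC (A ⊗[R] B) I₂)),
        Φ (x ⊗ₜ[A ⊗[R] B] y) = LaurentPolynomial.C x * θ (y : LaurentPolynomial (A ⊗[R] B))) →
      Function.Injective Φ ∧
        Set.range ⇑Φ = (DNC (B ⊗[R] B) I₃ : Set (LaurentPolynomial (B ⊗[R] B)))) := by
  obtain ⟨n, ⟨ρ⟩⟩ := hA
  let ι : A →ₐ[R] B := IsScalarTower.toAlgHom R A B
  have hι : ι.toRingHom.Flat := RingHom.flat_algebraMap_iff.mpr ‹Module.Flat A B›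
  let f₁₂ : A ⊗[R] A →ₐ[R] A ⊗[R] B := Algebra.TensorProduct.map (AlgHom.id R A) ι
  let f₂₃ : A ⊗[R] B →ₐ[R] B ⊗[R] B := Algebra.TensorProduct.map ι (AlgHom.id R B)
  let f₂₃' : B ⊗[R] A →ₐ[R] B ⊗[R] B := Algebra.TensorProduct.map (AlgHom.id R B) ι
  have hf₁₂ : f₁₂.toRingHom.Flat := RingHom.Flat.tensorProductMap (RingHom.Flat.id A) hι
  have hf₂₃ : f₂₃.toRingHom.Flat := RingHom.Flat.tensorProductMap hι (RingHom.Flat.id B)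
  have hf₂₃' : f₂₃'.toRingHom.Flat := RingHom.Flat.tensorProductMap (RingHom.Flat.id B) hι
  have hI₁₂ : I₁.map f₁₂.toRingHom = I₂ := by
    rw [hI₁, hI₂]
    refine DNC.map_span_eq _ _ _ fun a ↦ ?_
    simp [f₁₂, ι]
  have hI₂₃ : I₂.map f₂₃.toRingHom = I₃ := by
    rw [hI₂, hI₃]
    refine DNC.map_span_eq _ _ _ fun a ↦ ?_
    simp [f₂₃, ι]
  obtain ⟨e₁, hC₁, he₁⟩ := DNC.exists_mvPolynomial_equiv_left ρ (AlgHom.id R A)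
  obtain ⟨e₂, hC₂, he₂⟩ := DNC.exists_mvPolynomial_equiv_right ρ ι
  obtain ⟨e₂', hC₂', he₂'⟩ := DNC.exists_mvPolynomial_equiv_left ρ ι
  refine ⟨fun ψ hC hX ↦ ?_, fun ψ hC hX ↦ ?_, fun ψ hC hX ↦ ?_, fun ψ hC hX ↦ ?_, ?_, ?_⟩
  · let _ : Algebra (A ⊗[R] A) (A ⊗[R] B) := f₁₂.toRingHom.toAlgebra
    have : Module.Flat (A ⊗[R] A) (A ⊗[R] B) := hf₁₂
    refine DNC.flat_of_polynomial e₁ (hI₁.trans he₁) hI₁₂ ψ (fun a ↦ ?_) hX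
    rw [hC, hC₁]
    exact congrArg _ (by simp [RingHom.algebraMap_toAlgebra, f₁₂])
  · refine DNC.flat_of_polynomial e₂ (hI₂.trans he₂) (Ideal.map_id I₂) ψ (fun b ↦ ?_) hX
    rw [hC, hC₂]
    rfl
  · let _ : Algebra (B ⊗[R] A) (B ⊗[R] B) := f₂₃'.toRingHom.toAlgebra
    have : Module.Flat (B ⊗[R] A) (B ⊗[R] B) := hf₂₃'
    refine DNC.flat_of_polynomial e₂' he₂' ?_ ψ (fun b ↦ ?_) hX
    · rw [hI₃]
      refine DNC.map_span_eq _ _ _ fun a ↦ ?_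
      simp [RingHom.algebraMap_toAlgebra, f₂₃', ι]
    · rw [hC, hC₂']
      exact congrArg _ (by simp [RingHom.algebraMap_toAlgebra, f₂₃'])
  · let _ : Algebra (A ⊗[R] B) (B ⊗[R] B) := f₂₃.toRingHom.toAlgebra
    have : Module.Flat (A ⊗[R] B) (B ⊗[R] B) := hf₂₃
    refine DNC.flat_of_polynomial e₂ (hI₂.trans he₂) hI₂₃ ψ (fun b ↦ ?_) hX
    rw [hC, hC₂]
    exact congrArg _ (by simp [RingHom.algebraMap_toAlgebra, f₂₃])
  · intro θ hC hT Φ hΦ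
    let _ : Algebra (A ⊗[R] A) (A ⊗[R] B) := f₁₂.toRingHom.toAlgebra
    have : Module.Flat (A ⊗[R] A) (A ⊗[R] B) := hf₁₂
    exact DNC.injective_and_range_of_tmul I₁ hI₁₂ θ hC hT Φ.toAddMonoidHom hΦ
  · intro θ hC hT Φ hΦ
    let _ : Algebra (A ⊗[R] B) (B ⊗[R] B) := f₂₃.toRingHom.toAlgebra
    have : Module.Flat (A ⊗[R] B) (B ⊗[R] B) := hf₂₃
    exact DNC.injective_and_range_of_tmul I₂ hI₂₃ θ hC hT Φ.toAddMonoidHom hΦ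
end
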